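/- Let $r \in \mathbb{N}$ and let $(\xi,\Lambda)$ be a cubature formula on $[0,1)^d$. For $\mathbf{u} \in (0,1/2]^d$, let $\delta(\mathbf{z},\mathbf{u})$ be the error of $(\xi,\Lambda)$ on the shifted periodized $r$-smooth hat function with shift $\mathbf{z}$ and shape $\mathbf{u}$. Then for every $\mathbf{u} \in (0,1/2]^d$, $\|\delta(\cdot,\mathbf{u})\|_{L_2([0,1)^d)} \le \|g_{\xi,\Lambda,F_{r,0}}\|_{L_2}$, where $g_{\xi,\Lambda,F_{r,0}}(\mathbf{x}) = \sum_{\mathbf{k}} \Lambda(\xi,\mathbf{k}) \prod_{j=1}^d \bar k_j^{-r} e^{2\pi i(\mathbf{k},\mathbf{x})} - 1$ is the generalized diaphony function. -/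

import Mathlib

open MeasureTheory Real
open scoped ENNReal

/-- `h^1(x,u)`, the characteristic function of `[-u/2, u/2)`. -/
noncomputable def hOne (u x : ℝ) : ℝ := Set.indicator (Set.Ico (-u / 2) (u / 2)) (fun _ => 1) x

/-- `hIter u n = h^{n+1}(·,u)`: the `(n+1)`-fold self-convolution of `h^1(·,u)`. -/
noncomputable def hIter (u : ℝ) : ℕ → ℝ → ℝ
  | 0 => hOne u
  | n + 1 => fun x => ∫ y : ℝ, hIter u n (x - y) * hOne u y

/-- `perHat u r x = tilde h^r(x, u)`: the 1-periodization of `h^r(·,u)` (for `r ≥ 1`). -/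
noncomputable def perHat (u : ℝ) (r : ℕ) (x : ℝ) : ℝ := ∑' m : ℤ, hIter u (r - 1) (x + m)

/-- The multivariate periodized `r`-smooth hat function
`tilde h^r(x, z, u) = ∏_j tilde h^r(x_j - z_j, u_j)`. -/
noncomputable def perHatD (r : ℕ) {d : ℕ} (z u x : Fin d → ℝ) : ℝ :=
  ∏ j, perHat (u j) r (x j - z j)

/-- The unit cube `[0,1)^d`. -/
def unitCube (d : ℕ) : Set (Fin d → ℝ) := Set.univ.pi fun _ => Set.Ico (0 : ℝ) 1

/-- The cube of shape parameters `(0, 1/2]^d`. -/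
def shapeCube (d : ℕ) : Set (Fin d → ℝ) := Set.univ.pi fun _ => Set.Ioc (0 : ℝ) (1 / 2)

/-- The exponential sum `Λ(ξ, k) = ∑_μ λ_μ e^{2πi (k, ξ^μ)}`. -/
noncomputable def expSum {d m : ℕ} (ξ : Fin m → Fin d → ℝ) (lam : Fin m → ℂ)
    (k : Fin d → ℤ) : ℂ :=
  ∑ μ, lam μ * Complex.exp (2 * π * Complex.I * ∑ j, (k j : ℂ) * (ξ μ j : ℂ))

/-- The error `δ(z,u)` of the cubature formula `(ξ, Λ)` on the periodized
`r`-smooth hat function with shift `z` and shape `u`. -/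
noncomputable def deltaErr (r : ℕ) {d m : ℕ} (ξ : Fin m → Fin d → ℝ) (lam : Fin m → ℂ)
    (z u : Fin d → ℝ) : ℂ :=
  (∑ μ, lam μ * (perHatD r z u (ξ μ) : ℂ)) - ∫ x in unitCube d, (perHatD r z u x : ℂ)


section OneDim

lemma hOne_nonneg (u x : ℝ) : 0 ≤ hOne u x := by
  unfold hOne
  exact Set.indicator_nonneg (fun _ _ => zero_le_one) x

lemma hOne_le_one (u x : ℝ) : hOne u x ≤ 1 := by
  unfold hOne
  exact Set.indicator_le_self' (fun _ _ => zero_le_one) x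

lemma measurable_hOne (u : ℝ) : Measurable (hOne u) :=
  measurable_const.indicator measurableSet_Ico

lemma integrable_hOne (u : ℝ) : Integrable (hOne u) := by
  have : IntegrableOn (fun _ : ℝ => (1 : ℝ)) (Set.Ico (-u / 2) (u / 2)) :=
    integrableOn_const (by simp)
  exact this.integrable_indicator measurableSet_Ico

lemma hIter_nonneg (u : ℝ) (n : ℕ) (x : ℝ) : 0 ≤ hIter u n x := by
  induction n generalizing x with
  | zero => exact hOne_nonneg u x
  | succ n ih => exact integral_nonneg fun y => mul_nonneg (ih _) (hOne_nonneg _ _)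

lemma measurable_hIter (u : ℝ) (n : ℕ) : Measurable (hIter u n) := by
  induction n with
  | zero => exact measurable_hOne u
  | succ n ih =>
    have h : Measurable (fun p : ℝ × ℝ => hIter u n (p.1 - p.2) * hOne u p.2) :=
      (ih.comp (measurable_fst.sub measurable_snd)).mul ((measurable_hOne u).comp measurable_snd)
    exact (h.stronglyMeasurable.integral_prod_right (ν := volume)).measurable

lemma integral_hOne {u : ℝ} (hu : 0 < u) : ∫ x, hOne u x = u := by
  unfold hOne
  rw [integral_indicator measurableSet_Ico]
  simp only [integral_const, smul_eq_mul, mul_one, measureReal_restrict_apply_univ,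
    Real.volume_real_Ico]
  rw [max_eq_left] <;> linarith

lemma hIter_le_one {u : ℝ} (hu : 0 < u) (hu' : u ≤ 1 / 2) (n : ℕ) (x : ℝ) :
    hIter u n x ≤ 1 := by
  induction n generalizing x with
  | zero => exact hOne_le_one u x
  | succ n ih =>
    calc hIter u (n + 1) x ≤ ∫ y, hOne u y := by
          apply integral_mono_of_nonneg
          · exact Filter.Eventually.of_forall fun y =>
              mul_nonneg (hIter_nonneg _ _ _) (hOne_nonneg _ _)
          · exact integrable_hOne u
          · exact Filter.Eventually.of_forall fun y =>
              mul_le_of_le_one_left (hOne_nonneg _ _) (ih _)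
      _ = u := integral_hOne hu
      _ ≤ 1 := by linarith

lemma hIter_eq_zero {u : ℝ} (hu : 0 < u) (hu' : u ≤ 1 / 2) (n : ℕ) (x : ℝ)
    (hx : (n : ℝ) + 1 < |x|) : hIter u n x = 0 := by
  induction n generalizing x with
  | zero =>
    simp only [hIter, hOne]
    apply Set.indicator_of_notMem
    rintro ⟨h1, h2⟩
    have : |x| ≤ 1 := abs_le.2 ⟨by linarith, by linarith⟩
    simp at hx
    linarith
  | succ n ih =>
    simp only [hIter]
    apply integral_eq_zero_of_ae
    refine Filter.Eventually.of_forall fun y => ?_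
    simp only [Pi.zero_apply]
    by_cases hy : y ∈ Set.Ico (-u / 2) (u / 2)
    · rw [ih, zero_mul]
      have h1 : |y| ≤ 1 := abs_le.2 ⟨by linarith [hy.1], by linarith [hy.2]⟩
      have h2 := abs_sub_abs_le_abs_sub x y
      push_cast at hx
      linarith
    · rw [hOne, Set.indicator_of_notMem hy, mul_zero]

lemma integrable_hIter {u : ℝ} (hu : 0 < u) (hu' : u ≤ 1 / 2) (n : ℕ) :
    Integrable (hIter u n) := by
  have hc : IntegrableOn (hIter u n) (Set.Icc (-((n : ℝ) + 1)) (n + 1)) := by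
    apply Measure.integrableOn_of_bounded (M := 1)
    · simp
    · exact (measurable_hIter u n).aestronglyMeasurable
    · refine Filter.Eventually.of_forall fun x => ?_
      rw [Real.norm_of_nonneg (hIter_nonneg _ _ _)]
      exact hIter_le_one hu hu' n x
  refine (integrableOn_iff_integrable_of_support_subset ?_).1 hc
  intro x hx
  by_contra h
  apply hx
  apply hIter_eq_zero hu hu'
  by_contra h'
  exact h (abs_le.1 (not_lt.1 h'))

/-- the exponential `e^{-2 π i k x}` -/
noncomputable def ek (k : ℤ) (x : ℝ) : ℂ := fourier (-k) (x : UnitAddCircle)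

lemma ek_add (k : ℤ) (x y : ℝ) : ek k (x + y) = ek k x * ek k y := by
  simp only [ek, AddCircle.coe_add, fourier_apply, smul_add, AddCircle.toCircle_add, Circle.coe_mul]

lemma ek_int (k m : ℤ) : ek k m = 1 := by
  have : ((m : ℝ) : UnitAddCircle) = 0 := by
    rw [AddCircle.coe_eq_zero_iff]; exact ⟨m, by simp⟩
  simp [ek, this]

lemma norm_ek (k : ℤ) (x : ℝ) : ‖ek k x‖ = 1 := by
  rw [ek, fourier_apply]; exact Circle.norm_coe _

lemma ek_eq (k : ℤ) (x : ℝ) : ek k x = Complex.exp (-(2 * π * Complex.I * k) * x) := by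
  rw [ek, fourier_coe_apply]
  congr 1
  push_cast
  ring

lemma continuous_ek (k : ℤ) : Continuous (ek k) := by
  have : ek k = fun x : ℝ => Complex.exp (-(2 * π * Complex.I * k) * x) := funext (ek_eq k)
  rw [this]; fun_prop

lemma integrable_mul_ek {f : ℝ → ℝ} (hf : Integrable f) (k : ℤ) :
    Integrable (fun x => ek k x * (f x : ℂ)) := by
  refine hf.ofReal.bdd_mul (c := 1) (continuous_ek k).aestronglyMeasurable ?_
  exact Filter.Eventually.of_forall fun x => (norm_ek k x).le

/-- Fourier coefficient of the indicator. -/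
noncomputable def ck (u : ℝ) (k : ℤ) : ℂ := ∫ x : ℝ, ek k x * (hOne u x : ℂ)

lemma fourier_hIter {u : ℝ} (hu : 0 < u) (hu' : u ≤ 1 / 2) (n : ℕ) (k : ℤ) :
    ∫ x : ℝ, ek k x * (hIter u n x : ℂ) = ck u k ^ (n + 1) := by
  induction n with
  | zero => simp [ck, hIter]
  | succ n ih =>
    have h := integral_convolution (μ := volume) (ν := volume) (ContinuousLinearMap.mul ℝ ℂ)
      (integrable_mul_ek (integrable_hOne u) k)
      (integrable_mul_ek (integrable_hIter hu hu' n) k)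
    rw [pow_succ, ← ih, mul_comm]
    refine Eq.trans ?_ h
    congr 1
    ext x
    simp only [convolution, ContinuousLinearMap.mul_apply', hIter]
    rw [← integral_complex_ofReal, ← integral_const_mul]
    congr 1
    ext y
    have : ek k x = ek k y * ek k (x - y) := by rw [← ek_add]; congr 1; ring
    rw [this]
    push_cast
    ring

lemma ck_zero {u : ℝ} (hu : 0 < u) : ck u 0 = u := by
  have : ∀ x, ek 0 x = 1 := fun x => by simp [ek_eq]
  simp only [ck, this, one_mul]
  rw [integral_complex_ofReal, integral_hOne hu]

lemma ck_bound {u : ℝ} (hu : 0 < u) (hu' : u ≤ 1 / 2) (k : ℤ) :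
    ‖ck u k‖ ≤ (max |(k : ℝ)| 1)⁻¹ := by
  by_cases hk : k = 0
  · subst hk
    rw [ck_zero hu]
    simp [abs_of_pos hu]
    linarith
  · have hk1 : (1 : ℝ) ≤ |(k : ℝ)| := by
      exact_mod_cast Int.one_le_abs hk
    rw [max_eq_left hk1]
    have hne : -(2 * π * Complex.I * k) ≠ 0 := by
      simp [Real.pi_ne_zero, hk]
    have h : ck u k = ∫ x in (-u / 2)..(u / 2), Complex.exp (-(2 * π * Complex.I * k) * x) := by
      rw [intervalIntegral.integral_of_le (by linarith), ← integral_Ico_eq_integral_Ioc,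
        ← integral_indicator measurableSet_Ico, ck]
      congr 1
      ext x
      by_cases hx : x ∈ Set.Ico (-u / 2) (u / 2) <;> simp [hOne, hx, ek_eq]
    rw [h, integral_exp_mul_complex hne, ← ek_eq, ← ek_eq, norm_div]
    have h1 : ‖-(2 * π * Complex.I * k)‖ = 2 * π * |(k : ℝ)| := by
      simp [abs_of_pos Real.pi_pos]
    rw [h1]
    have h2 : ‖ek k (u / 2) - ek k (-u / 2)‖ ≤ 2 := by
      refine (norm_sub_le _ _).trans ?_
      rw [norm_ek, norm_ek]; norm_num
    rw [div_le_iff₀ (by positivity)]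
    refine h2.trans ?_
    have : |(k : ℝ)|⁻¹ * (2 * π * |(k : ℝ)|) = 2 * π := by
      field_simp
    rw [this]
    linarith [Real.pi_gt_three]

lemma measurable_perHat (u : ℝ) (r : ℕ) : Measurable (perHat u r) := by
  have : perHat u r = fun x => (∑' m : ℤ, ENNReal.ofReal (hIter u (r - 1) (x + m))).toReal := by
    ext x
    rw [ENNReal.tsum_toReal_eq (fun _ => ENNReal.ofReal_ne_top)]
    simp only [perHat, ENNReal.toReal_ofReal (hIter_nonneg _ _ _)]
  rw [this]
  refine Measurable.ennreal_toReal (Measurable.tsum fun m => ?_)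
  exact ((measurable_hIter u _).comp (measurable_id.add_const _)).ennreal_ofReal

lemma periodic_perHat (u : ℝ) (r : ℕ) : Function.Periodic (perHat u r) 1 := by
  intro x
  unfold perHat
  rw [← (Equiv.addRight (1 : ℤ)).tsum_eq (fun m : ℤ => hIter u (r - 1) (x + m))]
  congr 1
  ext m
  simp only [Equiv.coe_addRight]
  congr 1
  push_cast
  ring

lemma perHat_eq_sum {u : ℝ} (hu : 0 < u) (hu' : u ≤ 1 / 2) (r : ℕ) {x : ℝ}
    (hx : x ∈ Set.Icc (0 : ℝ) 1) :
    perHat u r x = ∑ m ∈ Finset.Icc (-(r + 3 : ℤ)) (r + 3), hIter u (r - 1) (x + m) := by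
  unfold perHat
  refine tsum_eq_sum fun m hm => ?_
  apply hIter_eq_zero hu hu'
  have h1 : ((r - 1 : ℕ) : ℝ) ≤ r := by exact_mod_cast Nat.sub_le r 1
  have h2 : (r + 3 : ℤ) < |m| := by
    by_contra h
    apply hm
    rw [Finset.mem_Icc]
    exact abs_le.1 (not_lt.1 h)
  have h3 : (r + 3 : ℝ) < |(m : ℝ)| := by exact_mod_cast h2
  have h4 := abs_sub_abs_le_abs_sub (m : ℝ) (-x)
  rw [abs_neg, abs_of_nonneg hx.1, sub_neg_eq_add, add_comm (m : ℝ)] at h4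
  linarith [hx.2]

lemma perHat_bounded {u : ℝ} (hu : 0 < u) (hu' : u ≤ 1 / 2) (r : ℕ) :
    ∃ C, ∀ x, ‖perHat u r x‖ ≤ C := by
  refine ⟨∑ m ∈ Finset.Icc (-(r + 3 : ℤ)) (r + 3), 1, fun x => ?_⟩
  have : perHat u r x = perHat u r (Int.fract x) := by
    have := (periodic_perHat u r).sub_int_mul_eq (x := x) ⌊x⌋
    rw [mul_one] at this
    rw [← this]; rfl
  rw [this, perHat_eq_sum hu hu' r ⟨Int.fract_nonneg x, (Int.fract_lt_one x).le⟩]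
  refine (norm_sum_le _ _).trans (Finset.sum_le_sum fun m _ => ?_)
  rw [Real.norm_of_nonneg (hIter_nonneg _ _ _)]
  exact hIter_le_one hu hu' _ _

lemma integral_perHat {u : ℝ} (hu : 0 < u) (hu' : u ≤ 1 / 2) {r : ℕ} (hr : 1 ≤ r) (k : ℤ) :
    ∫ x in (0 : ℝ)..1, ek k x * (perHat u r x : ℂ) = ck u k ^ r := by
  have hint := integrable_mul_ek (integrable_hIter hu hu' (r - 1)) k
  have h1 := hint.hasSum_intervalIntegral_comp_add_int
  rw [fourier_hIter hu hu', Nat.sub_add_cancel hr] at h1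
  rw [← h1.tsum_eq, tsum_eq_sum (s := Finset.Icc (-(r + 3 : ℤ)) (r + 3)),
    ← intervalIntegral.integral_finsetSum]
  · apply intervalIntegral.integral_congr
    intro x hx
    rw [Set.uIcc_of_le zero_le_one] at hx
    simp only
    rw [perHat_eq_sum hu hu' r hx]
    push_cast
    rw [Finset.mul_sum]
    refine Finset.sum_congr rfl fun m _ => ?_
    rw [ek_add, ek_int, mul_one]
  · intro m _
    exact (hint.comp_add_right (m : ℝ)).intervalIntegrable
  · intro m hm
    rw [intervalIntegral.integral_congr (g := fun _ => 0)]
    · simp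
    · intro x hx
      rw [Set.uIcc_of_le zero_le_one] at hx
      simp only
      rw [hIter_eq_zero hu hu']
      · simp
      have h1 : ((r - 1 : ℕ) : ℝ) ≤ r := by exact_mod_cast Nat.sub_le r 1
      have h2 : (r + 3 : ℤ) < |m| := by
        by_contra h
        apply hm
        rw [Finset.mem_Icc]
        exact abs_le.1 (not_lt.1 h)
      have h3 : (r + 3 : ℝ) < |(m : ℝ)| := by exact_mod_cast h2
      have h4 := abs_sub_abs_le_abs_sub (m : ℝ) (-x)
      rw [abs_neg, abs_of_nonneg hx.1, sub_neg_eq_add, add_comm (m : ℝ)] at h4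
      linarith [hx.2]

end OneDim

section Torus

noncomputable local instance instMeasureSpaceUnitCircle : MeasureSpace UnitAddCircle :=
  ⟨AddCircle.haarAddCircle⟩

local instance instHaarUnitCircle : Measure.IsAddHaarMeasure (volume : Measure UnitAddCircle) :=
  inferInstanceAs (Measure.IsAddHaarMeasure AddCircle.haarAddCircle)

local instance instProbUnitCircle : IsProbabilityMeasure (volume : Measure UnitAddCircle) :=
  inferInstanceAs (IsProbabilityMeasure AddCircle.haarAddCircle)

open UnitAddTorus

/-- `perHat` on the circle. -/
noncomputable def circHat (u : ℝ) (r : ℕ) (t : UnitAddCircle) : ℂ :=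
  (((periodic_perHat u r).lift t : ℝ) : ℂ)

lemma circHat_coe (u : ℝ) (r : ℕ) (x : ℝ) : circHat u r (x : UnitAddCircle) = perHat u r x := by
  rw [circHat, Function.Periodic.lift_coe]

lemma measurable_circHat (u : ℝ) (r : ℕ) : Measurable (circHat u r) := by
  have : circHat u r = fun t : UnitAddCircle =>
      ((perHat u r (AddCircle.measurableEquivIco 1 0 t : ℝ) : ℝ) : ℂ) := by
    ext t
    rw [← circHat_coe]
    congr 1
    exact (AddCircle.coe_equivIco (p := (1 : ℝ)) (a := 0) (y := t)).symm
  rw [this]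
  exact Complex.measurable_ofReal.comp ((measurable_perHat u r).comp
    (measurable_subtype_coe.comp (AddCircle.measurableEquivIco 1 0).measurable))

lemma circHat_bounded {u : ℝ} (hu : 0 < u) (hu' : u ≤ 1 / 2) (r : ℕ) :
    ∃ C, ∀ t, ‖circHat u r t‖ ≤ C := by
  obtain ⟨C, hC⟩ := perHat_bounded hu hu' r
  refine ⟨C, fun t => ?_⟩
  induction t using QuotientAddGroup.induction_on with
  | H x =>
    have := circHat_coe u r x
    rw [this, Complex.norm_real]
    exact hC x

lemma fourierCoeff_circHat {u : ℝ} (hu : 0 < u) (hu' : u ≤ 1 / 2) {r : ℕ} (hr : 1 ≤ r) (k : ℤ) :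
    ∫ t : UnitAddCircle, fourier (-k) t * circHat u r t = ck u k ^ r := by
  have h := fourierCoeff_eq_intervalIntegral (T := 1) (circHat u r) k 0
  rw [← integral_perHat hu hu' hr k]
  simp only [fourierCoeff, smul_eq_mul, div_one, one_smul, zero_add] at h
  refine h.trans ?_
  simp only [circHat_coe]
  rfl

lemma fourierCoeff_circHat_shift {u : ℝ} (hu : 0 < u) (hu' : u ≤ 1 / 2) {r : ℕ} (hr : 1 ≤ r)
    (k : ℤ) (x : UnitAddCircle) :
    ∫ t : UnitAddCircle, fourier (-k) t * circHat u r (x - t)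
      = fourier (-k) x * ck u (-k) ^ r := by
  rw [← fourierCoeff_circHat hu hu' hr (-k), ← integral_const_mul,
    ← integral_sub_left_eq_self (fun t : UnitAddCircle =>
      fourier (-k) x * (fourier (- -k) t * circHat u r t)) volume x]
  congr 1
  ext t
  rw [← mul_assoc]
  congr 1
  simp only [fourier_apply, neg_neg, ← Circle.coe_mul, ← AddCircle.toCircle_add]
  congr 2
  simp only [smul_sub, neg_smul]
  abel

lemma integrable_circHat_shift {u : ℝ} (hu : 0 < u) (hu' : u ≤ 1 / 2) (r : ℕ)
    (k : ℤ) (x : UnitAddCircle) :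
    Integrable (fun t : UnitAddCircle => fourier (-k) t * circHat u r (x - t)) := by
  obtain ⟨C, hC⟩ := circHat_bounded hu hu' r
  refine Integrable.of_bound (C := C) ?_ ?_
  · exact ((map_continuous (fourier (-k))).measurable.mul
      ((measurable_circHat u r).comp (measurable_const.sub measurable_id))).aestronglyMeasurable
  · refine Filter.Eventually.of_forall fun t => ?_
    rw [norm_mul, fourier_apply, Circle.norm_coe, one_mul]
    exact hC _

variable {d : ℕ}

lemma integral_cube {E : Type*} [NormedAddCommGroup E] [NormedSpace ℝ E]
    (f : UnitAddTorus (Fin d) → E) :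
    ∫ z in unitCube d, f (fun j => (z j : UnitAddCircle)) = ∫ t, f t := by
  rw [UnitAddTorus.integral_preimage f 0]
  apply setIntegral_congr_set
  have h1 := Measure.univ_pi_Ico_ae_eq_Icc (μ := fun _ : Fin d => (volume : Measure ℝ))
    (f := fun _ => 0) (g := fun _ => 1)
  have h2 := Measure.univ_pi_Ioc_ae_eq_Icc (μ := fun _ : Fin d => (volume : Measure ℝ))
    (f := fun _ => 0) (g := fun _ => 1)
  have h3 := h1.trans h2.symm
  have h4 : {x : Fin d → ℝ | ∀ i, x i ∈ Set.Ioc ((0 : Fin d → ℝ) i) ((0 : Fin d → ℝ) i + 1)}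
      = Set.univ.pi fun _ => Set.Ioc (0 : ℝ) 1 := by
    ext x; simp [Set.mem_pi]
  rw [h4]
  exact h3

/-- the error on the torus -/
noncomputable def torusErr (r : ℕ) {m : ℕ} (ξ : Fin m → Fin d → ℝ) (lam : Fin m → ℂ)
    (u : Fin d → ℝ) (t : UnitAddTorus (Fin d)) : ℂ :=
  (∑ μ, lam μ * ∏ j, circHat (u j) r ((ξ μ j : UnitAddCircle) - t j)) - ∏ j, ck (u j) 0 ^ r

lemma deltaErr_eq {r m : ℕ} (hr : 1 ≤ r) (ξ : Fin m → Fin d → ℝ) (lam : Fin m → ℂ)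
    (u : Fin d → ℝ) (hu : u ∈ shapeCube d) (z : Fin d → ℝ) :
    deltaErr r ξ lam z u = torusErr r ξ lam u (fun j => (z j : UnitAddCircle)) := by
  have hp : ∀ x : Fin d → ℝ, (perHatD r z u x : ℂ)
      = ∏ j, circHat (u j) r ((x j : UnitAddCircle) - (z j : UnitAddCircle)) := by
    intro x
    rw [perHatD]
    push_cast
    refine Finset.prod_congr rfl fun j _ => ?_
    rw [← circHat_coe]
    rfl
  unfold deltaErr torusErr
  simp only [hp]
  congr 1
  rw [integral_cube (fun t : UnitAddTorus (Fin d) =>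
    ∏ j, circHat (u j) r (t j - (z j : UnitAddCircle)))]
  rw [integral_fintype_prod_volume_eq_prod
    (f := fun j (s : UnitAddCircle) => circHat (u j) r (s - (z j : UnitAddCircle)))]
  refine Finset.prod_congr rfl fun j _ => ?_
  have huj := hu j (Set.mem_univ j)
  rw [integral_sub_right_eq_self (fun s : UnitAddCircle => circHat (u j) r s),
    ← fourierCoeff_circHat huj.1 huj.2 hr 0]
  simp

lemma integral_mFourier (k : Fin d → ℤ) :
    ∫ t : UnitAddTorus (Fin d), mFourier k t = if k = 0 then 1 else 0 := by
  split_ifs with h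
  · subst h
    simp [mFourier_zero]
  · simp only [mFourier, ContinuousMap.coe_mk]
    rw [integral_fintype_prod_volume_eq_prod (f := fun j (s : UnitAddCircle) => fourier (k j) s)]
    obtain ⟨i, hi⟩ := Function.ne_iff.mp h
    apply Finset.prod_eq_zero (Finset.mem_univ i)
    exact integral_eq_zero_of_add_right_eq_neg (μ := AddCircle.haarAddCircle)
      (fourier_add_half_inv_index hi (by norm_num))

lemma expSum_eq {m : ℕ} (ξ : Fin m → Fin d → ℝ) (lam : Fin m → ℂ) (k : Fin d → ℤ) :
    expSum ξ lam k = ∑ μ, lam μ * ∏ j, fourier (k j) (ξ μ j : UnitAddCircle) := by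
  unfold expSum
  refine Finset.sum_congr rfl fun μ _ => ?_
  congr 1
  rw [Finset.mul_sum, Complex.exp_sum]
  refine Finset.prod_congr rfl fun j _ => ?_
  rw [fourier_coe_apply]
  congr 1
  push_cast
  ring

lemma norm_expSum_le {m : ℕ} (ξ : Fin m → Fin d → ℝ) (lam : Fin m → ℂ) (k : Fin d → ℤ) :
    ‖expSum ξ lam k‖ ≤ ∑ μ, ‖lam μ‖ := by
  rw [expSum_eq]
  refine (norm_sum_le _ _).trans (Finset.sum_le_sum fun μ _ => ?_)
  rw [norm_mul, norm_prod]
  simp only [fourier_apply, Circle.norm_coe, Finset.prod_const_one, mul_one, le_refl]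

lemma coeff_torusErr {r m : ℕ} (hr : 1 ≤ r) (ξ : Fin m → Fin d → ℝ) (lam : Fin m → ℂ)
    (u : Fin d → ℝ) (hu : u ∈ shapeCube d) (k : Fin d → ℤ) :
    mFourierCoeff (torusErr r ξ lam u) (-k)
      = expSum ξ lam k * ∏ j, ck (u j) (k j) ^ r
        - (if k = 0 then 1 else 0) * ∏ j, ck (u j) 0 ^ r := by
  have hu1 : ∀ j, 0 < u j := fun j => (hu j (Set.mem_univ j)).1
  have hu2 : ∀ j, u j ≤ 1 / 2 := fun j => (hu j (Set.mem_univ j)).2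
  have hI : ∀ μ, Integrable (fun t : UnitAddTorus (Fin d) =>
      lam μ * ∏ j, (fourier (- -k j) (t j) * circHat (u j) r ((ξ μ j : UnitAddCircle) - t j))) := by
    intro μ
    exact (Integrable.fintype_prod_dep (f := fun j (s : UnitAddCircle) =>
      fourier (- -k j) s * circHat (u j) r ((ξ μ j : UnitAddCircle) - s))
      (fun j => integrable_circHat_shift (hu1 j) (hu2 j) r (-k j) _)).const_mul _
  have hc : Integrable (fun t : UnitAddTorus (Fin d) => mFourier k t * ∏ j, ck (u j) 0 ^ r) :=
    ((map_continuous (mFourier k)).integrable_of_hasCompactSupport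
      (HasCompactSupport.of_compactSpace _)).mul_const _
  have e : ∀ t : UnitAddTorus (Fin d), mFourier (- -k) t • torusErr r ξ lam u t
      = (∑ μ, lam μ * ∏ j, (fourier (- -k j) (t j)
          * circHat (u j) r ((ξ μ j : UnitAddCircle) - t j)))
        - mFourier k t * ∏ j, ck (u j) 0 ^ r := by
    intro t
    rw [torusErr, smul_eq_mul, mul_sub, neg_neg, Finset.mul_sum]
    congr 1
    refine Finset.sum_congr rfl fun μ _ => ?_
    rw [Finset.prod_mul_distrib]
    simp only [neg_neg, mFourier, ContinuousMap.coe_mk]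
    ring
  unfold mFourierCoeff
  simp only [e]
  rw [integral_sub (integrable_finsetSum _ fun μ _ => hI μ) hc,
    integral_finsetSum _ (fun μ _ => hI μ), integral_mul_const, integral_mFourier,
    expSum_eq, Finset.sum_mul]
  congr 1
  refine Finset.sum_congr rfl fun μ _ => ?_
  rw [integral_const_mul, mul_assoc, ← Finset.prod_mul_distrib]
  congr 1
  rw [integral_fintype_prod_volume_eq_prod (f := fun j (s : UnitAddCircle) =>
      fourier (- -k j) s * circHat (u j) r ((ξ μ j : UnitAddCircle) - s))]
  refine Finset.prod_congr rfl fun j _ => ?_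
  rw [fourierCoeff_circHat_shift (hu1 j) (hu2 j) hr, neg_neg]

lemma memLp_torusErr (r : ℕ) {m : ℕ} (ξ : Fin m → Fin d → ℝ) (lam : Fin m → ℂ)
    (u : Fin d → ℝ) (hu : u ∈ shapeCube d) : MemLp (torusErr r ξ lam u) 2 := by
  have hb : ∀ j, ∃ C, ∀ t, ‖circHat (u j) r t‖ ≤ C := fun j =>
    circHat_bounded (hu j (Set.mem_univ j)).1 (hu j (Set.mem_univ j)).2 r
  choose C hC using hb
  refine MemLp.of_bound (C := (∑ μ, ‖lam μ‖ * ∏ j, C j) + ‖∏ j, ck (u j) 0 ^ r‖) ?_ ?_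
  · apply Measurable.aestronglyMeasurable
    unfold torusErr
    refine Measurable.sub_const (Finset.measurable_sum _ fun μ _ => ?_) _
    refine Measurable.const_mul (Finset.measurable_prod _ fun j _ => ?_) _
    have hm : Measurable (fun t : UnitAddTorus (Fin d) => (ξ μ j : UnitAddCircle) - t j) :=
      (measurable_pi_apply j).const_sub _
    exact (measurable_circHat _ _).comp hm
  · refine Filter.Eventually.of_forall fun t => ?_
    refine (norm_sub_le _ _).trans ?_
    gcongr
    refine (norm_sum_le _ _).trans (Finset.sum_le_sum fun μ _ => ?_)
    rw [norm_mul, norm_prod]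
    gcongr with j
    exact hC j _

lemma parseval {f : UnitAddTorus (Fin d) → ℂ} (hf : MemLp f 2) :
    HasSum (fun k => ‖mFourierCoeff f k‖ ^ 2) (∫ t, ‖f t‖ ^ 2) := by
  have h := hasSum_sq_mFourierCoeff hf.toLp
  have h1 : ∀ k, mFourierCoeff (hf.toLp) k = mFourierCoeff f k := by
    intro k
    apply integral_congr_ae
    filter_upwards [hf.coeFn_toLp] with t ht
    rw [ht]
  have h2 : ∫ t, ‖(hf.toLp f) t‖ ^ 2 = ∫ t, ‖f t‖ ^ 2 := by
    apply integral_congr_ae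
    filter_upwards [hf.coeFn_toLp] with t ht
    rw [ht]
  simp only [h1, h2] at h
  exact h

lemma summable_prod_fin {g : ℤ → ℝ} (hg : Summable g) (h0 : ∀ k, 0 ≤ g k) (d : ℕ) :
    Summable (fun k : Fin d → ℤ => ∏ j, g (k j)) := by
  induction d with
  | zero => exact Summable.of_finite
  | succ n ih =>
    rw [← (Fin.consEquiv (fun _ : Fin (n + 1) => ℤ)).summable_iff]
    have := hg.mul_of_nonneg ih h0 (fun k => Finset.prod_nonneg fun j _ => h0 _)
    refine this.congr fun p => ?_
    simp [Fin.prod_univ_succ, Fin.consEquiv]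

lemma summable_weight {r : ℕ} (hr : 1 ≤ r) :
    Summable (fun k : ℤ => ((max |(k : ℝ)| 1) ^ (2 * r))⁻¹) := by
  have h : Summable (fun k : ℤ => 1 / (k : ℝ) ^ 2) :=
    Real.summable_one_div_int_pow.2 (by norm_num)
  have h' : Summable (fun k : ℤ => (if k = 0 then (1 : ℝ) else 0) + 1 / (k : ℝ) ^ 2) :=
    (hasSum_ite_eq (0 : ℤ) (1 : ℝ)).summable.add h
  refine Summable.of_nonneg_of_le (fun k => by positivity) (fun k => ?_) h'
  by_cases hk : k = 0
  · simp [hk]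
  · have hk1 : (1 : ℝ) ≤ |(k : ℝ)| := by exact_mod_cast Int.one_le_abs hk
    rw [max_eq_left hk1, if_neg hk, zero_add, one_div, ← sq_abs (k : ℝ)]
    gcongr
    omega

end Torus

theorem stmt11 (r d m : ℕ) (hr : 1 ≤ r) (hd : 1 ≤ d)
    (ξ : Fin m → Fin d → ℝ) (lam : Fin m → ℂ)
    (u : Fin d → ℝ) (hu : u ∈ shapeCube d) :
    (∫ z in unitCube d, ‖deltaErr r ξ lam z u‖ ^ 2)
      ≤ ‖expSum ξ lam 0 - 1‖ ^ 2 +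
        ∑' k : Fin d → ℤ,
          if k = 0 then 0
          else ‖expSum ξ lam k‖ ^ 2 * ∏ j, ((max |(k j : ℝ)| 1) ^ (2 * r))⁻¹ := by
  have hS : Summable (fun k : Fin d → ℤ => if k = 0 then 0
      else ‖expSum ξ lam k‖ ^ 2 * ∏ j, ((max |(k j : ℝ)| 1) ^ (2 * r))⁻¹) := by
    have h := (summable_prod_fin (summable_weight hr) (fun k => by positivity) d).mul_left
      ((∑ μ, ‖lam μ‖) ^ 2)
    refine Summable.of_nonneg_of_le (fun k => ?_) (fun k => ?_) h
    · split_ifs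
      · exact le_rfl
      · positivity
    · split_ifs
      · positivity
      · gcongr
        exact norm_expSum_le ξ lam k
  have h1 := (hasSum_ite_eq (0 : Fin d → ℤ) (‖expSum ξ lam 0 - 1‖ ^ 2)).add hS.hasSum
  have h2 := parseval (memLp_torusErr r ξ lam u hu)
  rw [← (Equiv.neg (Fin d → ℤ)).hasSum_iff] at h2
  have h3 : ∫ z in unitCube d, ‖deltaErr r ξ lam z u‖ ^ 2 = _ :=
    (integral_congr_ae (Filter.Eventually.of_forall fun z => by
      simp only [deltaErr_eq hr ξ lam u hu z])).trans
      (integral_cube (fun t => ‖torusErr r ξ lam u t‖ ^ 2))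
  rw [h3]
  refine hasSum_le (fun k => ?_) h2 h1
  have hu1 : ∀ j, 0 < u j := fun j => (hu j (Set.mem_univ j)).1
  have hu2 : ∀ j, u j ≤ 1 / 2 := fun j => (hu j (Set.mem_univ j)).2
  have hb : ‖∏ j, ck (u j) (k j) ^ r‖ ^ 2 ≤ ∏ j, ((max |(k j : ℝ)| 1) ^ (2 * r))⁻¹ := by
    rw [norm_prod, ← Finset.prod_pow]
    refine Finset.prod_le_prod (fun j _ => by positivity) fun j _ => ?_
    rw [norm_pow, ← pow_mul, mul_comm r 2, ← inv_pow]
    gcongr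
    exact ck_bound (hu1 j) (hu2 j) (k j)
  simp only [Function.comp_apply, Equiv.neg_apply]
  rw [coeff_torusErr hr ξ lam u hu k]
  by_cases hk : k = 0
  · subst hk
    simp only [if_true, add_zero, mul_zero, zero_add, Pi.zero_apply] at hb ⊢
    rw [← sub_mul, norm_mul, mul_pow]
    refine mul_le_of_le_one_right (by positivity) (hb.trans ?_)
    simp
  · simp only [hk, if_false, mul_zero, zero_add, zero_mul, sub_zero]
    rw [norm_mul, mul_pow]
    gcongr
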